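/- Let u ∈ C²(B₁) with 0 ≤ u < 1 be a stable solution of −Δu = f(u) in the unit ball B₁ ⊂ ℝⁿ, where f ∈ C²([0,1)) satisfies f ≥ 0 and there exist θ > 0, K ≥ 0 with f″(t)f(t) ≥ (1+θ)f′(t)² − K for all 0 ≤ t < 1. Then there exists a constant C, depending only on n, θ, and K, such that ‖f(u)‖_{W^{1,2}(B_{1/2})} ≤ C ‖u‖_{L¹(B_{3/4})}, i.e., ∫_{B_{1/2}} ( f(u)² + |∇(f∘u)|² ) dx ≤ C² (∫_{B_{3/4}} u dx)². -/

import Mathlib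

open MeasureTheory Set Filter Topology Bornology Metric

/-- The Laplacian of `u : ℝⁿ → ℝ`, as the sum of second partial derivatives. -/
noncomputable def lap {n : ℕ} (u : EuclideanSpace ℝ (Fin n) → ℝ)
    (x : EuclideanSpace ℝ (Fin n)) : ℝ :=
  ∑ i, fderiv ℝ (fun y => fderiv ℝ u y (EuclideanSpace.single i 1)) x (EuclideanSpace.single i 1)

/-- `f` is of class `C²([0,1))`, with first and second derivatives `f'`, `f''`. -/
def C2On01 (f f' f'' : ℝ → ℝ) : Prop :=
  (∀ t ∈ Ico (0:ℝ) 1, HasDerivWithinAt f (f' t) (Ico (0:ℝ) 1) t) ∧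
  (∀ t ∈ Ico (0:ℝ) 1, HasDerivWithinAt f' (f'' t) (Ico (0:ℝ) 1) t) ∧
  ContinuousOn f'' (Ico (0:ℝ) 1)

/-- Stability of a solution `u` of `-Δu = f(u)` in `Ω`: nonnegativity of the second variation of
the energy on all smooth test functions compactly supported in `Ω`. Here `f'` is the derivative
of the nonlinearity. -/
def StableSol {n : ℕ} (f' : ℝ → ℝ) (u : EuclideanSpace ℝ (Fin n) → ℝ)
    (Ω : Set (EuclideanSpace ℝ (Fin n))) : Prop :=
  ∀ ξ : EuclideanSpace ℝ (Fin n) → ℝ, ContDiff ℝ (⊤:ℕ∞) ξ → HasCompactSupport ξ →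
    tsupport ξ ⊆ Ω →
    0 ≤ ∫ x in Ω, (‖gradient ξ x‖ ^ 2 - f' (u x) * ξ x ^ 2)

section Gradient

variable {E : Type*} [NormedAddCommGroup E] [InnerProductSpace ℝ E] [CompleteSpace E]

lemma norm_gradient (g : E → ℝ) (x : E) : ‖gradient g x‖ = ‖fderiv ℝ g x‖ := by
  simp [gradient]

lemma continuous_gradient {g : E → ℝ} (hg : ContDiff ℝ 1 g) : Continuous (gradient g) :=
  (InnerProductSpace.toDual ℝ E).symm.continuous.comp (hg.continuous_fderiv one_ne_zero)

lemma HasCompactSupport.gradient {g : E → ℝ} (hg : HasCompactSupport g) :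
    HasCompactSupport (gradient g) :=
  (hg.fderiv ℝ).comp_left (map_zero _)

lemma gradient_eq_zero_of_notMem_tsupport {g : E → ℝ} {x : E} (hx : x ∉ tsupport g) :
    gradient g x = 0 := by
  have h : fderiv ℝ g x = 0 := by
    by_contra h'
    exact hx (support_fderiv_subset ℝ h')
  simp [gradient, h]

lemma HasFDerivAt.gradient_eq_of_smul {g u : E → ℝ} {c : ℝ} {x : E}
    (h : HasFDerivAt g (c • fderiv ℝ u x) x) : _root_.gradient g x = c • _root_.gradient u x := by
  rw [_root_.gradient, h.fderiv, map_smul]; rfl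

lemma gradient_mul {a b : E → ℝ} {x : E} (ha : DifferentiableAt ℝ a x)
    (hb : DifferentiableAt ℝ b x) :
    gradient (fun y => a y * b y) x = a x • gradient b x + b x • gradient a x := by
  simp only [gradient]
  rw [fderiv_fun_mul ha hb, map_add, map_smul, map_smul]

end Gradient

section Integral

variable {E : Type*} [NormedAddCommGroup E] [InnerProductSpace ℝ E] [FiniteDimensional ℝ E]
  [MeasurableSpace E] [BorelSpace E]

lemma integral_fderiv_apply_eq_zero {g : E → ℝ} (hg : ContDiff ℝ 1 g) (hc : HasCompactSupport g)
    (v : E) : ∫ x, fderiv ℝ g x v = 0 := by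
  have h1 : Continuous fun x => fderiv ℝ g x v :=
    (hg.continuous_fderiv one_ne_zero).clm_apply continuous_const
  have h2 : HasCompactSupport fun x => fderiv ℝ g x v := hc.fderiv_apply ℝ v
  have := integral_mul_fderiv_eq_neg_fderiv_mul_of_integrable (𝕜 := ℝ) (μ := (volume : Measure E))
    (f := fun _ : E => (1 : ℝ)) (g := g) (v := v) (by simp)
    (by simpa using h1.integrable_of_hasCompactSupport h2)
    (by simpa using hg.continuous.integrable_of_hasCompactSupport hc)
    (fun x _ => differentiableAt_const _) (fun x _ => (hg.differentiable one_ne_zero) x)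
  simpa using this

/-- The difference quotient estimate `‖g(· + h) - g‖₂ ≤ |h| ‖∇g‖₂`. -/
lemma integral_sq_translate_sub_le {g : E → ℝ} (hg : ContDiff ℝ 1 g) (hc : HasCompactSupport g)
    (h : E) : ∫ x, (g (x + h) - g x) ^ 2 ≤ ‖h‖ ^ 2 * ∫ x, ‖gradient g x‖ ^ 2 := by
  have hG : Continuous fun x => ‖gradient g x‖ ^ 2 := (continuous_gradient hg).norm.pow 2
  have hGc : HasCompactSupport fun x => ‖gradient g x‖ ^ 2 :=
    hc.gradient.comp_left (g := fun v => ‖v‖ ^ 2) (by simp)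
  have hpt : ∀ x, (g (x + h) - g x) ^ 2 ≤
      ‖h‖ ^ 2 * ∫ t in (0:ℝ)..1, ‖gradient g (x + t • h)‖ ^ 2 := by
    intro x
    set a : ℝ → ℝ := fun t => fderiv ℝ g (x + t • h) h with ha
    have hline : Continuous fun t : ℝ => x + t • h := by fun_prop
    have hac : Continuous a :=
      ((hg.continuous_fderiv one_ne_zero).comp hline).clm_apply continuous_const
    have hd : ∀ t : ℝ, HasDerivAt (fun t : ℝ => g (x + t • h)) (a t) t := by
      intro t
      have h1 : HasDerivAt (fun t : ℝ => x + t • h) h t := by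
        simpa using ((hasDerivAt_id t).smul_const h).const_add x
      exact ((hg.differentiable one_ne_zero) (x + t • h)).hasFDerivAt.comp_hasDerivAt t h1
    have hm : ∫ t in (0:ℝ)..1, a t = g (x + h) - g x := by
      have := intervalIntegral.integral_eq_sub_of_hasDerivAt (fun t _ => hd t)
        (hac.intervalIntegrable 0 1)
      simpa using this
    set m := g (x + h) - g x
    have h0 : 0 ≤ ∫ t in (0:ℝ)..1, (a t - m) ^ 2 :=
      intervalIntegral.integral_nonneg zero_le_one fun t _ => sq_nonneg _
    have h1 : ∫ t in (0:ℝ)..1, (a t - m) ^ 2 = (∫ t in (0:ℝ)..1, a t ^ 2) - m ^ 2 := by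
      have e : ∀ t, (a t - m) ^ 2 = a t ^ 2 - 2 * m * a t + m ^ 2 := fun t => by ring
      simp_rw [e]
      rw [intervalIntegral.integral_add, intervalIntegral.integral_sub,
        intervalIntegral.integral_const_mul, hm]
      · simp; ring
      all_goals exact Continuous.intervalIntegrable (by fun_prop) _ _
    have h2 : ∫ t in (0:ℝ)..1, a t ^ 2 ≤
        ∫ t in (0:ℝ)..1, ‖h‖ ^ 2 * ‖gradient g (x + t • h)‖ ^ 2 := by
      refine intervalIntegral.integral_mono_on zero_le_one
        (Continuous.intervalIntegrable (by fun_prop) _ _)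
        (Continuous.intervalIntegrable (continuous_const.mul (hG.comp hline)) _ _) fun t _ => ?_
      have : |a t| ≤ ‖gradient g (x + t • h)‖ * ‖h‖ := by
        rw [norm_gradient]; exact (fderiv ℝ g (x + t • h)).le_opNorm h
      rw [← sq_abs, ← mul_pow, mul_comm]
      exact pow_le_pow_left₀ (abs_nonneg _) this 2
    rw [intervalIntegral.integral_const_mul] at h2
    linarith
  have hsw : ∫ x, ∫ t in (0:ℝ)..1, ‖gradient g (x + t • h)‖ ^ 2 = ∫ x, ‖gradient g x‖ ^ 2 ∧
      Integrable fun x => ∫ t in (0:ℝ)..1, ‖gradient g (x + t • h)‖ ^ 2 := by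
    have hcont : Continuous fun p : E × ℝ => ‖gradient g (p.1 + p.2 • h)‖ ^ 2 :=
      hG.comp (by fun_prop : Continuous fun p : E × ℝ => p.1 + p.2 • h)
    have h_integrable : Integrable (fun p : E × ℝ => ‖gradient g (p.1 + p.2 • h)‖ ^ 2)
        ((volume : Measure E).prod (volume.restrict (Ioc (0:ℝ) 1))) := by
      rw [integrable_prod_iff' hcont.aestronglyMeasurable]
      refine ⟨ae_of_all _ fun t =>
        (hG.integrable_of_hasCompactSupport hGc).comp_add_right (t • h), ?_⟩
      have : ∀ t : ℝ, ∫ x, ‖‖gradient g (x + t • h)‖ ^ 2‖ = ∫ x, ‖gradient g x‖ ^ 2 := by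
        intro t
        simp_rw [norm_pow, norm_norm]
        exact integral_add_right_eq_self (fun x => ‖gradient g x‖ ^ 2) (t • h)
      simp_rw [this]
      exact integrable_const _
    simp_rw [intervalIntegral.integral_of_le zero_le_one]
    refine ⟨?_, h_integrable.integral_prod_left⟩
    rw [integral_integral_swap h_integrable]
    have : ∀ t : ℝ, ∫ x, ‖gradient g (x + t • h)‖ ^ 2 = ∫ x, ‖gradient g x‖ ^ 2 := fun t =>
      integral_add_right_eq_self (fun x => ‖gradient g x‖ ^ 2) (t • h)
    simp [this]
  calc ∫ x, (g (x + h) - g x) ^ 2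
      ≤ ∫ x, ‖h‖ ^ 2 * ∫ t in (0:ℝ)..1, ‖gradient g (x + t • h)‖ ^ 2 :=
        integral_mono_of_nonneg (ae_of_all _ fun x => sq_nonneg _) (hsw.2.const_mul _)
          (ae_of_all _ hpt)
    _ = _ := by rw [integral_const_mul, hsw.1]

/-- Interpolation of `L²` between `L¹` and the Dirichlet energy, at scale `ε`. -/
lemma integral_sq_le_dirichlet_add_sq_integral {g : E → ℝ} (hg : ContDiff ℝ 1 g)
    (hc : HasCompactSupport g) {ε : ℝ} (hε : 0 < ε) :
    ∫ x, g x ^ 2 ≤ ε ^ 2 / 2 * (∫ x, ‖gradient g x‖ ^ 2) +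
      (volume.real (ball (0 : E) ε))⁻¹ * (∫ x, |g x|) ^ 2 := by
  set V := volume.real (ball (0 : E) ε) with hV
  have hVpos : 0 < V := ENNReal.toReal_pos (measure_ball_pos _ _ hε).ne' measure_ball_lt_top.ne
  have hgi : Integrable g := hg.continuous.integrable_of_hasCompactSupport hc
  have hg2c : Continuous fun x => g x ^ 2 := hg.continuous.pow 2
  have hg2s : HasCompactSupport fun x => g x ^ 2 :=
    hc.comp_left (g := fun t : ℝ => t ^ 2) (by simp)
  have hg2 : Integrable fun x => g x ^ 2 := hg2c.integrable_of_hasCompactSupport hg2s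
  have hprod : ∀ h : E, Integrable fun x => g x * g (x + h) := fun h =>
    (hg.continuous.mul (hg.continuous.comp (by fun_prop))).integrable_of_hasCompactSupport
      hc.mul_right
  have key : ∀ h ∈ ball (0 : E) ε, ∫ x, g x ^ 2 ≤
      ε ^ 2 / 2 * (∫ x, ‖gradient g x‖ ^ 2) + ∫ x, |g x| * |g (x + h)| := by
    intro h hh
    have hh' : ‖h‖ < ε := by simpa using hh
    have h1 := integral_sq_translate_sub_le hg hc h
    have hgh : Integrable fun x => g (x + h) ^ 2 := hg2.comp_add_right h
    have e : ∀ x, (g (x + h) - g x) ^ 2 = g (x + h) ^ 2 - 2 * (g x * g (x + h)) + g x ^ 2 :=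
      fun x => by ring
    simp_rw [e] at h1
    have i1 : Integrable fun x => g (x + h) ^ 2 - 2 * (g x * g (x + h)) :=
      hgh.sub ((hprod h).const_mul 2)
    rw [integral_add i1 hg2,
      integral_sub hgh ((hprod h).const_mul 2), integral_const_mul,
      integral_add_right_eq_self (fun x => g x ^ 2) h] at h1
    have h2 : ∫ x, g x * g (x + h) ≤ ∫ x, |g x| * |g (x + h)| :=
      integral_mono (hprod h) (by simpa [abs_mul] using (hprod h).abs)
        fun x => by simpa [abs_mul] using le_abs_self (g x * g (x + h))
    have h3 : ‖h‖ ^ 2 * (∫ x, ‖gradient g x‖ ^ 2) ≤ ε ^ 2 * ∫ x, ‖gradient g x‖ ^ 2 :=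
      mul_le_mul_of_nonneg_right (pow_le_pow_left₀ (norm_nonneg _) hh'.le 2)
        (integral_nonneg fun x => sq_nonneg _)
    linarith
  have h_integrable : Integrable (fun p : E × E => |g p.1| * |g p.2|)
      ((volume : Measure E).prod (volume : Measure E)) := hgi.abs.mul_prod hgi.abs
  have hint2 : Integrable (fun p : E × E => |g p.1| * |g (p.1 + p.2)|)
      ((volume : Measure E).prod (volume : Measure E)) := by
    exact (measurePreserving_prod_add (volume : Measure E) volume).integrable_comp_of_integrable h_integrable
  have hswap : ∫ h, ∫ x, |g x| * |g (x + h)| = (∫ x, |g x|) ^ 2 := by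
    rw [integral_integral_swap (f := fun h x => |g x| * |g (x + h)|) hint2.swap]
    simp_rw [integral_const_mul]
    have : ∀ x, ∫ h, |g (x + h)| = ∫ x, |g x| := fun x =>
      integral_add_left_eq_self (fun y => |g y|) x
    simp_rw [this]
    rw [integral_mul_const, sq]
  have hIh : Integrable fun h => ∫ x, |g x| * |g (x + h)| := hint2.integral_prod_right
  have hball : volume (ball (0 : E) ε) ≠ ⊤ := measure_ball_lt_top.ne
  have hle : ∫ h in ball (0 : E) ε, ∫ x, |g x| * |g (x + h)| ≤ (∫ x, |g x|) ^ 2 := by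
    rw [← hswap]
    exact setIntegral_le_integral hIh
      (ae_of_all _ fun h => integral_nonneg fun x => by positivity)
  generalize (∫ x, g x ^ 2) = S at key ⊢
  generalize ε ^ 2 / 2 * (∫ x, ‖gradient g x‖ ^ 2) = D at key ⊢
  generalize (∫ x, |g x|) ^ 2 = N at hle ⊢
  have avg : V * S ≤ V * D + N := by
    have h1 := setIntegral_mono_on (integrableOn_const (C := S) hball)
      ((integrableOn_const (C := D) hball).add hIh.integrableOn) measurableSet_ball key
    have h3 := integral_add (integrableOn_const (C := D) hball) hIh.integrableOn
    simp only [Pi.add_apply] at h1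
    rw [h3, setIntegral_const, setIntegral_const, ← hV, smul_eq_mul, smul_eq_mul] at h1
    linarith
  calc S = V⁻¹ * (V * S) := by field_simp
    _ ≤ V⁻¹ * (V * D + N) := by gcongr
    _ = _ := by field_simp

end Integral

section Cutoff

lemma exists_bound_deriv_smoothTransition :
    ∃ C : ℝ, ∀ t, |deriv Real.smoothTransition t| ≤ C := by
  have hs : ContDiff ℝ 1 Real.smoothTransition := Real.smoothTransition.contDiff (n := 1)
  have hc : Continuous (deriv Real.smoothTransition) := hs.continuous_deriv le_rfl
  refine hc.bounded_above_of_compact_support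
    (HasCompactSupport.intro (isCompact_Icc (a := (0:ℝ)) (b := 1)) fun t ht => ?_)
  rw [mem_Icc, not_and_or, not_le, not_le] at ht
  rcases ht with ht | ht
  · have : Real.smoothTransition =ᶠ[𝓝 t] fun _ => 0 := by
      filter_upwards [Iio_mem_nhds ht] with y hy
      exact Real.smoothTransition.zero_of_nonpos (le_of_lt hy)
    rw [this.deriv_eq, deriv_const]
  · have : Real.smoothTransition =ᶠ[𝓝 t] fun _ => 1 := by
      filter_upwards [Ioi_mem_nhds ht] with y hy
      exact Real.smoothTransition.one_of_one_le (le_of_lt hy)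
    rw [this.deriv_eq, deriv_const]

/-- A smooth cutoff between concentric balls of radii `r` and `s`. -/
structure IsCutoff {E : Type*} [NormedAddCommGroup E] [InnerProductSpace ℝ E] [CompleteSpace E]
    (C r s : ℝ) (η : E → ℝ) : Prop where
  contDiff : ContDiff ℝ (⊤ : ℕ∞) η
  hasCompactSupport : HasCompactSupport η
  tsupport_subset : tsupport η ⊆ closedBall 0 s
  nonneg : ∀ x, 0 ≤ η x
  le_one : ∀ x, η x ≤ 1
  eq_one : ∀ x ∈ closedBall (0 : E) r, η x = 1
  norm_gradient_le : ∀ x, ‖gradient η x‖ ≤ C / (s - r)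

namespace IsCutoff

variable {E : Type*} [NormedAddCommGroup E] [InnerProductSpace ℝ E] [CompleteSpace E]
  {C r s : ℝ} {η : E → ℝ}

lemma eq_zero (hη : IsCutoff C r s η) {x : E}
    (hx : x ∉ closedBall (0 : E) s) : η x = 0 :=
  image_eq_zero_of_notMem_tsupport fun h => hx (hη.tsupport_subset h)

lemma gradient_eq_zero (hη : IsCutoff C r s η) {x : E}
    (hx : x ∉ closedBall (0 : E) s) : gradient η x = 0 :=
  gradient_eq_zero_of_notMem_tsupport fun h => hx (hη.tsupport_subset h)

lemma contDiff_one (hη : IsCutoff C r s η) : ContDiff ℝ 1 η :=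
  hη.contDiff.of_le (by exact_mod_cast le_top)

lemma contDiff_two (hη : IsCutoff C r s η) : ContDiff ℝ 2 η :=
  contDiff_infty.1 hη.contDiff 2

lemma norm_gradient_sq_le (hη : IsCutoff C r s η) (x : E) :
    ‖gradient η x‖ ^ 2 ≤ C ^ 2 / (s - r) ^ 2 := by
  rw [← div_pow]
  exact pow_le_pow_left₀ (norm_nonneg _) (hη.norm_gradient_le x) 2

lemma sq_le_one (hη : IsCutoff C r s η) (x : E) :
    η x ^ 2 ≤ 1 := pow_le_one₀ (hη.nonneg x) (hη.le_one x)

end IsCutoff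

lemma exists_cutoff (E : Type*) [NormedAddCommGroup E] [InnerProductSpace ℝ E]
    [FiniteDimensional ℝ E] :
    ∃ C : ℝ, 0 < C ∧ ∀ r s : ℝ, 1 / 2 ≤ r → r < s → s ≤ 1 → ∃ η : E → ℝ, IsCutoff C r s η := by
  obtain ⟨C, hC⟩ := exists_bound_deriv_smoothTransition
  have hC0 : 0 ≤ C := (abs_nonneg _).trans (hC 0)
  refine ⟨2 * C + 1, by positivity, fun r s hr hrs hs => ?_⟩
  have hw : 0 < s ^ 2 - r ^ 2 := by nlinarith
  set q : E → ℝ := fun x => (s ^ 2 - ‖x‖ ^ 2) / (s ^ 2 - r ^ 2) with hq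
  set η : E → ℝ := fun x => Real.smoothTransition (q x) with hη
  have hqd : ContDiff ℝ (⊤ : ℕ∞) q := (contDiff_const.sub (contDiff_norm_sq ℝ)).div_const _
  have hηd : ContDiff ℝ (⊤ : ℕ∞) η := Real.smoothTransition.contDiff.comp hqd
  have hsupp : tsupport η ⊆ closedBall 0 s := by
    refine closure_minimal (fun x hx => ?_) isClosed_closedBall
    rw [mem_closedBall_zero_iff]
    by_contra! h
    refine hx (Real.smoothTransition.zero_of_nonpos ?_)
    exact div_nonpos_of_nonpos_of_nonneg (by nlinarith) hw.le
  refine ⟨η, hηd, HasCompactSupport.of_support_subset_isCompact (isCompact_closedBall 0 s)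
    (subset_closure.trans hsupp), hsupp, fun x => Real.smoothTransition.nonneg _,
    fun x => Real.smoothTransition.le_one _, fun x hx => ?_, fun x => ?_⟩
  · rw [mem_closedBall_zero_iff] at hx
    refine Real.smoothTransition.one_of_one_le ?_
    rw [hq, le_div_iff₀ hw]
    nlinarith [norm_nonneg x]
  · have hpos : 0 < s - r := by linarith
    by_cases hx : x ∈ tsupport η
    · have hxs : ‖x‖ ≤ 1 := by simpa using (mem_closedBall_zero_iff.1 (hsupp hx)).trans hs
      have hq' : HasFDerivAt q ((-(2 / (s ^ 2 - r ^ 2))) • innerSL ℝ x) x := by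
        have h1 : HasFDerivAt (fun y : E => ‖y‖ ^ 2) (2 • innerSL ℝ x) x :=
          (hasStrictFDerivAt_norm_sq x).hasFDerivAt
        have h2 := (h1.const_sub (s ^ 2)).mul_const (s ^ 2 - r ^ 2)⁻¹
        refine (h2.congr_fderiv ?_).congr_of_eventuallyEq (Eventually.of_forall fun y => ?_)
        · ext v
          simp
          ring
        · simp [hq, div_eq_mul_inv]
      have hχ : HasDerivAt Real.smoothTransition (deriv Real.smoothTransition (q x)) (q x) :=
        ((Real.smoothTransition.contDiff (n := 1)).differentiable one_ne_zero _).hasDerivAt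
      have h3 := hχ.comp_hasFDerivAt x hq'
      rw [norm_gradient, show fderiv ℝ η x = _ from h3.fderiv, norm_smul, norm_smul,
        innerSL_apply_norm, Real.norm_eq_abs, norm_neg, Real.norm_eq_abs,
        abs_of_nonneg (by positivity : (0:ℝ) ≤ 2 / (s ^ 2 - r ^ 2))]
      have h4 : 2 / (s ^ 2 - r ^ 2) ≤ 2 / (s - r) :=
        div_le_div_of_nonneg_left zero_le_two hpos (by nlinarith)
      calc |deriv Real.smoothTransition (q x)| * (2 / (s ^ 2 - r ^ 2) * ‖x‖)
          ≤ C * (2 / (s - r) * 1) := by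
            gcongr
            exact hC _
        _ ≤ (2 * C + 1) / (s - r) := by
            rw [mul_one, mul_div_assoc', mul_comm C]
            gcongr
            linarith
    · rw [gradient_eq_zero_of_notMem_tsupport hx, norm_zero]
      positivity

end Cutoff

section WeakFormulation

variable {n : ℕ}

lemma inner_gradient_eq_sum (a b : EuclideanSpace ℝ (Fin n) → ℝ) (x : EuclideanSpace ℝ (Fin n)) :
    inner ℝ (gradient a x) (gradient b x) =
      ∑ i, fderiv ℝ a x (EuclideanSpace.single i 1) * fderiv ℝ b x (EuclideanSpace.single i 1) := by
  rw [← (EuclideanSpace.basisFun (Fin n) ℝ).sum_inner_mul_inner]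
  refine Finset.sum_congr rfl fun i _ => ?_
  rw [EuclideanSpace.basisFun_apply, inner_gradient_left, real_inner_comm, inner_gradient_left]

lemma contDiff_fderiv_apply {u : EuclideanSpace ℝ (Fin n) → ℝ} (hu : ContDiff ℝ 2 u)
    (v : EuclideanSpace ℝ (Fin n)) : ContDiff ℝ 1 fun y => fderiv ℝ u y v :=
  (hu.fderiv_right (m := 1) (by norm_num)).clm_apply contDiff_const

lemma continuous_lap {u : EuclideanSpace ℝ (Fin n) → ℝ} (hu : ContDiff ℝ 2 u) :
    Continuous (lap u) :=
  continuous_finsetSum _ fun _ _ =>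
    ((contDiff_fderiv_apply hu _).continuous_fderiv one_ne_zero).clm_apply continuous_const

/-- Green's first identity against a compactly supported test function. -/
lemma integral_inner_gradient_add_mul_lap {u φ : EuclideanSpace ℝ (Fin n) → ℝ}
    (hu : ContDiff ℝ 2 u) (hφ : ContDiff ℝ 1 φ) (hc : HasCompactSupport φ) :
    ∫ x, (inner ℝ (gradient φ x) (gradient u x) + φ x * lap u x) = 0 := by
  have hg : ∀ i : Fin n, ContDiff ℝ 1 fun y => φ y * fderiv ℝ u y (EuclideanSpace.single i 1) :=
    fun _ => hφ.mul (contDiff_fderiv_apply hu _)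
  have hgc : ∀ i : Fin n,
      HasCompactSupport fun y => φ y * fderiv ℝ u y (EuclideanSpace.single i 1) :=
    fun _ => hc.mul_right
  have hpt : ∀ x, inner ℝ (gradient φ x) (gradient u x) + φ x * lap u x =
      ∑ i, fderiv ℝ (fun y => φ y * fderiv ℝ u y (EuclideanSpace.single i 1)) x
        (EuclideanSpace.single i 1) := by
    intro x
    rw [inner_gradient_eq_sum, lap, Finset.mul_sum, ← Finset.sum_add_distrib]
    refine Finset.sum_congr rfl fun i _ => ?_
    rw [fderiv_fun_mul (hφ.differentiable one_ne_zero x)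
      ((contDiff_fderiv_apply hu _).differentiable one_ne_zero x)]
    simp
    ring
  simp_rw [hpt]
  rw [integral_finsetSum]
  · exact Finset.sum_eq_zero fun i _ => integral_fderiv_apply_eq_zero (hg i) (hgc i) _
  · rintro i -
    exact (((hg i).continuous_fderiv one_ne_zero).clm_apply
      continuous_const).integrable_of_hasCompactSupport ((hgc i).fderiv_apply ℝ _)

lemma integral_mul_lap_comm {u η : EuclideanSpace ℝ (Fin n) → ℝ}
    (hu : ContDiff ℝ 2 u) (huc : HasCompactSupport u) (hη : ContDiff ℝ 2 η)
    (hηc : HasCompactSupport η) :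
    ∫ x, η x * lap u x = ∫ x, u x * lap η x := by
  have h1 := integral_inner_gradient_add_mul_lap hu (hη.of_le one_le_two) hηc
  have h2 := integral_inner_gradient_add_mul_lap hη (hu.of_le one_le_two) huc
  have hi : Integrable fun x => inner ℝ (gradient η x) (gradient u x) :=
    ((continuous_gradient (hη.of_le one_le_two)).inner
      (continuous_gradient (hu.of_le one_le_two))).integrable_of_hasCompactSupport
      (hηc.gradient.mono fun x hx h => hx (by simp [h]))
  have hi1 : Integrable fun x => η x * lap u x :=
    (hη.continuous.mul (continuous_lap hu)).integrable_of_hasCompactSupport hηc.mul_right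
  have hi2 : Integrable fun x => u x * lap η x :=
    (hu.continuous.mul (continuous_lap hη)).integrable_of_hasCompactSupport huc.mul_right
  rw [integral_add hi hi1] at h1
  simp_rw [real_inner_comm (gradient η _) (gradient u _)] at h2
  rw [integral_add hi hi2] at h2
  linarith

end WeakFormulation

section Approximation

variable {E : Type*} [NormedAddCommGroup E] [InnerProductSpace ℝ E] [FiniteDimensional ℝ E]
  [MeasurableSpace E] [BorelSpace E]

open scoped Convolution

lemma gradient_normed_convolution {ξ : E → ℝ} (hξ : ContDiff ℝ 1 ξ) (hc : HasCompactSupport ξ)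
    (φ : ContDiffBump (0 : E)) (x : E) :
    fderiv ℝ (φ.normed volume ⋆[ContinuousLinearMap.lsmul ℝ ℝ, volume] ξ) x =
      (φ.normed volume ⋆[ContinuousLinearMap.lsmul ℝ ℝ, volume] fderiv ℝ ξ) x := by
  rw [(hc.hasFDerivAt_convolution_right (ContinuousLinearMap.lsmul ℝ ℝ)
    φ.continuous_normed.locallyIntegrable hξ x).fderiv]
  rfl

lemma norm_normed_convolution_le {F : Type*} [NormedAddCommGroup F] [NormedSpace ℝ F]
    [CompleteSpace F] {g : E → F} (hg : Continuous g) {B : ℝ} (hB : ∀ x, ‖g x‖ ≤ B)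
    (φ : ContDiffBump (0 : E)) (x : E) :
    ‖(φ.normed volume ⋆[ContinuousLinearMap.lsmul ℝ ℝ, volume] g) x‖ ≤ 3 * B := by
  have h := φ.dist_normed_convolution_le (μ := volume) (x₀ := x) (ε := 2 * B)
    hg.aestronglyMeasurable fun y _ => by
      rw [dist_eq_norm]
      linarith [norm_sub_le (g y) (g x), hB x, hB y]
  rw [dist_eq_norm] at h
  have := norm_sub_norm_le ((φ.normed volume ⋆[ContinuousLinearMap.lsmul ℝ ℝ, volume] g) x) (g x)
  linarith [hB x]

/-- Nonnegativity of the second variation extends from smooth to `C¹` test functions. -/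
lemma secondVariation_nonneg_of_contDiff_one {P : E → ℝ} (hP : Continuous P) {Ω : Set E}
    (hΩ : IsOpen Ω)
    (h : ∀ ξ : E → ℝ, ContDiff ℝ (⊤ : ℕ∞) ξ → HasCompactSupport ξ → tsupport ξ ⊆ Ω →
      0 ≤ ∫ x, (‖gradient ξ x‖ ^ 2 - P x * ξ x ^ 2))
    {ξ : E → ℝ} (hξ : ContDiff ℝ 1 ξ) (hc : HasCompactSupport ξ) (hs : tsupport ξ ⊆ Ω) :
    0 ≤ ∫ x, (‖gradient ξ x‖ ^ 2 - P x * ξ x ^ 2) := by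
  obtain ⟨δ, hδ, hδΩ⟩ := hc.isCompact.exists_cthickening_subset_open hΩ hs
  set K := cthickening δ (tsupport ξ) with hK
  have hKc : IsCompact K := hc.isCompact.cthickening
  let φ : ℕ → ContDiffBump (0 : E) := fun i =>
    ⟨δ / (i + 2), δ / (i + 1), by positivity, by gcongr; norm_num⟩
  have hφ : Tendsto (fun i => (φ i).rOut) atTop (𝓝 0) := by
    simpa [φ, div_eq_mul_inv, one_div] using
      (tendsto_one_div_add_atTop_nhds_zero_nat (𝕜 := ℝ)).const_mul δ
  have hφδ : ∀ i, (φ i).rOut ≤ δ := fun i => by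
    simp only [φ]
    exact div_le_self hδ.le (by linarith [(Nat.cast_nonneg i : (0:ℝ) ≤ i)])
  set ζ : ℕ → E → ℝ := fun i =>
    (φ i).normed volume ⋆[ContinuousLinearMap.lsmul ℝ ℝ, volume] ξ with hζ
  have hζs : ∀ i, tsupport (ζ i) ⊆ K := fun i => by
    refine closure_minimal ((support_convolution_subset _).trans ?_) isClosed_cthickening
    rintro _ ⟨a, ha, b, hb, rfl⟩
    rw [(φ i).support_normed_eq, mem_ball_zero_iff] at ha
    refine mem_cthickening_of_dist_le _ b _ _ (subset_tsupport _ hb) ?_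
    simpa using ha.le.trans (hφδ i)
  have hζc : ∀ i, HasCompactSupport (ζ i) := fun i =>
    HasCompactSupport.of_support_subset_isCompact hKc (subset_closure.trans (hζs i))
  have hζd : ∀ i, ContDiff ℝ (⊤ : ℕ∞) (ζ i) := fun i =>
    (φ i).hasCompactSupport_normed.contDiff_convolution_left _ (φ i).contDiff_normed
      hξ.continuous.locallyIntegrable
  have hf : Continuous (fderiv ℝ ξ) := hξ.continuous_fderiv one_ne_zero
  obtain ⟨B₀, hB₀⟩ := hξ.continuous.bounded_above_of_compact_support hc
  obtain ⟨B₁, hB₁⟩ := hf.bounded_above_of_compact_support (hc.fderiv ℝ)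
  have hlim : Tendsto (fun i => ∫ x, (‖gradient (ζ i) x‖ ^ 2 - P x * ζ i x ^ 2)) atTop
      (𝓝 (∫ x, (‖gradient ξ x‖ ^ 2 - P x * ξ x ^ 2))) := by
    refine tendsto_integral_of_dominated_convergence
      (K.indicator fun x => (3 * B₁) ^ 2 + |P x| * (3 * B₀) ^ 2) (fun i => ?_) ?_ (fun i => ?_) ?_
    · have h1 : ContDiff ℝ 1 (ζ i) := (hζd i).of_le (by exact_mod_cast le_top)
      exact (((continuous_gradient h1).norm.pow 2).sub
        (hP.mul (h1.continuous.pow 2))).aestronglyMeasurable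
    · rw [integrable_indicator_iff hKc.measurableSet]
      exact (by fun_prop : Continuous fun x => (3 * B₁) ^ 2 + |P x| * (3 * B₀) ^ 2).continuousOn
        |>.integrableOn_compact hKc
    · refine ae_of_all _ fun x => ?_
      by_cases hx : x ∈ K
      · rw [indicator_of_mem hx, norm_gradient, gradient_normed_convolution hξ hc]
        refine (norm_sub_le _ _).trans (add_le_add ?_ ?_)
        · rw [norm_pow, norm_norm]
          exact pow_le_pow_left₀ (norm_nonneg _) (norm_normed_convolution_le hf hB₁ _ x) 2
        · rw [norm_mul, norm_pow, Real.norm_eq_abs (P x)]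
          gcongr
          exact norm_normed_convolution_le hξ.continuous hB₀ _ x
      · have h0 : ζ i x = 0 := image_eq_zero_of_notMem_tsupport fun h' => hx (hζs i h')
        have h1 : gradient (ζ i) x = 0 :=
          gradient_eq_zero_of_notMem_tsupport fun h' => hx (hζs i h')
        rw [indicator_of_notMem hx, h0, h1]
        simp
    · refine ae_of_all _ fun x => ?_
      simp_rw [norm_gradient, hζ, gradient_normed_convolution hξ hc]
      exact ((ContDiffBump.convolution_tendsto_right_of_continuous hφ hf x).norm.pow 2).sub
        (((ContDiffBump.convolution_tendsto_right_of_continuous hφ hξ.continuous x).pow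
          2).const_mul (P x))
  exact ge_of_tendsto' hlim fun i => h (ζ i) (hζd i) (hζc i) ((hζs i).trans hδΩ)

end Approximation

section Laplacian

variable {n : ℕ}

lemma Filter.EventuallyEq.lap_eq {u v : EuclideanSpace ℝ (Fin n) → ℝ}
    {x : EuclideanSpace ℝ (Fin n)} (h : u =ᶠ[𝓝 x] v) : lap u x = lap v x := by
  refine Finset.sum_congr rfl fun i _ => ?_
  have : (fun y => fderiv ℝ u y (EuclideanSpace.single i 1)) =ᶠ[𝓝 x]
      fun y => fderiv ℝ v y (EuclideanSpace.single i 1) := by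
    filter_upwards [h.fderiv (𝕜 := ℝ)] with y hy
    rw [hy]
  rw [this.fderiv_eq]

lemma lap_eq_zero_of_notMem_tsupport {u : EuclideanSpace ℝ (Fin n) → ℝ}
    {x : EuclideanSpace ℝ (Fin n)} (hx : x ∉ tsupport u) : lap u x = 0 := by
  rw [(notMem_tsupport_iff_eventuallyEq.1 hx).lap_eq]
  simp [lap]

end Laplacian

lemma le_two_mul_of_le_half_add {H : ℝ → ℝ} {ρ₀ B N : ℝ} (hN : 0 ≤ N)
    (hB : ∀ ρ, 0 < ρ → ρ ≤ ρ₀ → H ρ ≤ B)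
    (hH : ∀ ρ, 0 < ρ → ρ ≤ ρ₀ → H ρ ≤ H (ρ / 2) / 2 + N) {ρ : ℝ} (hρ : 0 < ρ) (hρ₀ : ρ ≤ ρ₀) :
    H ρ ≤ 2 * N := by
  have key : ∀ k : ℕ, ∀ ρ, 0 < ρ → ρ ≤ ρ₀ → H ρ ≤ B * (1 / 2) ^ k + 2 * N := by
    intro k
    induction k with
    | zero => intro ρ h0 h1; linarith [hB ρ h0 h1]
    | succ k ih =>
      intro ρ h0 h1
      have h2 := ih (ρ / 2) (by linarith) (by linarith)
      have h3 := hH ρ h0 h1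
      rw [pow_succ]
      linarith
  have hlim : Tendsto (fun k : ℕ => B * (1 / 2 : ℝ) ^ k + 2 * N) atTop (𝓝 (B * 0 + 2 * N)) :=
    ((tendsto_pow_atTop_nhds_zero_of_lt_one (by norm_num) (by norm_num)).const_mul B).add_const _
  simpa using ge_of_tendsto' hlim fun k => key k ρ hρ hρ₀

section LocalEstimates

variable {E : Type*} [NormedAddCommGroup E] [InnerProductSpace ℝ E] [FiniteDimensional ℝ E]
  [MeasurableSpace E] [BorelSpace E]

lemma Continuous.integrableOn_closedBall_zero {h : E → ℝ} (hh : Continuous h) (s : ℝ) :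
    IntegrableOn h (closedBall (0 : E) s) :=
  hh.continuousOn.integrableOn_compact (isCompact_closedBall _ _)

lemma integral_le_setIntegral_closedBall {k h : E → ℝ} {s : ℝ} (hk : Continuous k)
    (hh : Continuous h) (h0 : ∀ x ∉ closedBall (0 : E) s, k x = 0)
    (hle : ∀ x ∈ closedBall (0 : E) s, k x ≤ h x) :
    ∫ x, k x ≤ ∫ x in closedBall (0 : E) s, h x := by
  rw [← setIntegral_eq_integral_of_forall_compl_eq_zero h0]
  exact setIntegral_mono_on (hk.integrableOn_closedBall_zero s) (hh.integrableOn_closedBall_zero s)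
    measurableSet_closedBall hle

lemma setIntegral_closedBall_le_integral {k h : E → ℝ} {r : ℝ} (hh : Continuous h)
    (hk : Integrable k) (h0 : ∀ x, 0 ≤ k x) (hle : ∀ x ∈ closedBall (0 : E) r, h x ≤ k x) :
    ∫ x in closedBall (0 : E) r, h x ≤ ∫ x, k x :=
  (setIntegral_mono_on (hh.integrableOn_closedBall_zero r) hk.integrableOn
    measurableSet_closedBall hle).trans (setIntegral_le_integral hk (ae_of_all _ h0))

lemma setIntegral_closedBall_mono {h : E → ℝ} (hh : Continuous h) (h0 : ∀ x, 0 ≤ h x) {r s : ℝ}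
    (hrs : r ≤ s) :
    ∫ x in closedBall (0 : E) r, h x ≤ ∫ x in closedBall (0 : E) s, h x :=
  setIntegral_mono_set (hh.integrableOn_closedBall_zero s) (ae_of_all _ h0)
    (closedBall_subset_closedBall hrs).eventuallyLE

/-- Localized interpolation between nested balls, at scale `ε`. -/
lemma IsCutoff.setIntegral_sq_le {C r s : ℝ} {η : E → ℝ} (hη : IsCutoff C r s η) {g : E → ℝ}
    (hg : ContDiff ℝ 1 g) {ε : ℝ} (hε : 0 < ε) :
    ∫ x in closedBall (0 : E) r, g x ^ 2 ≤
      ε ^ 2 * (∫ x in closedBall (0 : E) s, ‖gradient g x‖ ^ 2) +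
      ε ^ 2 * (C ^ 2 / (s - r) ^ 2) * (∫ x in closedBall (0 : E) s, g x ^ 2) +
      (volume.real (ball (0 : E) ε))⁻¹ * (∫ x in closedBall (0 : E) s, |g x|) ^ 2 := by
  have hηd := hη.contDiff_one
  have hgc := hg.continuous
  have hηc := hηd.continuous
  have hGc := continuous_gradient hg
  have hk : ContDiff ℝ 1 fun x => η x * g x := hηd.mul hg
  have hks : HasCompactSupport fun x => η x * g x := hη.hasCompactSupport.mul_right
  have hk2c : Continuous fun x => (η x * g x) ^ 2 := hk.continuous.pow 2
  have hk2s : HasCompactSupport fun x => (η x * g x) ^ 2 :=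
    hks.comp_left (g := fun t : ℝ => t ^ 2) (by simp)
  have h1 := integral_sq_le_dirichlet_add_sq_integral hk hks hε
  have h2 : ∫ x in closedBall (0 : E) r, g x ^ 2 ≤ ∫ x, (η x * g x) ^ 2 := by
    refine setIntegral_closedBall_le_integral (hgc.pow 2)
      (hk2c.integrable_of_hasCompactSupport hk2s) (fun x => sq_nonneg _) fun x hx => ?_
    rw [hη.eq_one x hx, one_mul]
  have hgr : ∀ x, gradient (fun y => η y * g y) x = η x • gradient g x + g x • gradient η x :=
    fun x => gradient_mul (hηd.differentiable one_ne_zero x) (hg.differentiable one_ne_zero x)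
  have h3 : ∫ x, ‖gradient (fun y => η y * g y) x‖ ^ 2 ≤
      ∫ x in closedBall (0 : E) s,
        (2 * ‖gradient g x‖ ^ 2 + 2 * (C ^ 2 / (s - r) ^ 2) * g x ^ 2) := by
    refine integral_le_setIntegral_closedBall ((continuous_gradient hk).norm.pow 2)
      (by fun_prop) (fun x hx => ?_) fun x _ => ?_
    · rw [hgr, hη.eq_zero hx, hη.gradient_eq_zero hx]
      simp
    · rw [hgr]
      have a1 := norm_add_le (η x • gradient g x) (g x • gradient η x)
      have a2 : ‖η x • gradient g x‖ ^ 2 ≤ ‖gradient g x‖ ^ 2 := by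
        rw [norm_smul, mul_pow, Real.norm_eq_abs, sq_abs]
        exact mul_le_of_le_one_left (sq_nonneg _) (hη.sq_le_one x)
      have a3 : ‖g x • gradient η x‖ ^ 2 ≤ (C ^ 2 / (s - r) ^ 2) * g x ^ 2 := by
        rw [norm_smul, mul_pow, Real.norm_eq_abs, sq_abs, mul_comm]
        exact mul_le_mul_of_nonneg_right (hη.norm_gradient_sq_le x) (sq_nonneg _)
      have a4 := pow_le_pow_left₀ (norm_nonneg _) a1 2
      nlinarith [sq_nonneg (‖η x • gradient g x‖ - ‖g x • gradient η x‖)]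
  have i1 : IntegrableOn (fun x => 2 * ‖gradient g x‖ ^ 2) (closedBall (0 : E) s) :=
    Continuous.integrableOn_closedBall_zero (by fun_prop) s
  have i2 : IntegrableOn (fun x => 2 * (C ^ 2 / (s - r) ^ 2) * g x ^ 2) (closedBall (0 : E) s) :=
    Continuous.integrableOn_closedBall_zero (by fun_prop) s
  rw [integral_add i1 i2, integral_const_mul, integral_const_mul] at h3
  have h4 : ∫ x, |η x * g x| ≤ ∫ x in closedBall (0 : E) s, |g x| := by
    refine integral_le_setIntegral_closedBall hk.continuous.abs hgc.abs (fun x hx => ?_)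
      fun x _ => ?_
    · rw [hη.eq_zero hx]
      simp
    · rw [abs_mul, abs_of_nonneg (hη.nonneg x)]
      exact mul_le_of_le_one_left (abs_nonneg _) (hη.le_one x)
  have h5 : (∫ x, |η x * g x|) ^ 2 ≤ (∫ x in closedBall (0 : E) s, |g x|) ^ 2 :=
    pow_le_pow_left₀ (integral_nonneg fun x => abs_nonneg _) h4 2
  have h6 : (volume.real (ball (0 : E) ε))⁻¹ * (∫ x, |η x * g x|) ^ 2 ≤
      (volume.real (ball (0 : E) ε))⁻¹ * (∫ x in closedBall (0 : E) s, |g x|) ^ 2 :=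
    mul_le_mul_of_nonneg_left h5 (by positivity)
  have h7 := mul_le_mul_of_nonneg_left h3 (by positivity : 0 ≤ ε ^ 2 / 2)
  linarith

end LocalEstimates

/-- The data `F = f ∘ u`, `P = f' ∘ u`, `S = f'' ∘ u` of a stable solution on the ball of radius
`3/4`, extended to the whole space. -/
structure IsStableSystem {n : ℕ} (K : ℝ) (u F P S : EuclideanSpace ℝ (Fin n) → ℝ) : Prop where
  contDiff : ContDiff ℝ 2 u
  hasCompactSupport : HasCompactSupport u
  nonneg : ∀ x, 0 ≤ u x
  rhs_nonneg : ∀ x, 0 ≤ F x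
  hasFDerivAt_rhs : ∀ x, HasFDerivAt F (P x • fderiv ℝ u x) x
  hasFDerivAt_deriv : ∀ x, HasFDerivAt P (S x • fderiv ℝ u x) x
  continuous_deriv2 : Continuous S
  sq_sub_le : ∀ x, P x ^ 2 - K ≤ S x * F x
  neg_lap_eq : ∀ x ∈ ball (0 : EuclideanSpace ℝ (Fin n)) (3 / 4), -lap u x = F x
  stable : ∀ ξ : EuclideanSpace ℝ (Fin n) → ℝ, ContDiff ℝ (⊤ : ℕ∞) ξ → HasCompactSupport ξ →
    tsupport ξ ⊆ ball 0 (3 / 4) → 0 ≤ ∫ x, (‖gradient ξ x‖ ^ 2 - P x * ξ x ^ 2)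

lemma contDiff_one_of_hasFDerivAt_smul {E : Type*} [NormedAddCommGroup E] [NormedSpace ℝ E]
    {u g c : E → ℝ} (hu : ContDiff ℝ 1 u) (hc : Continuous c)
    (hg : ∀ x, HasFDerivAt g (c x • fderiv ℝ u x) x) : ContDiff ℝ 1 g := by
  rw [contDiff_one_iff_fderiv]
  refine ⟨fun x => (hg x).differentiableAt, ?_⟩
  rw [show fderiv ℝ g = fun x => c x • fderiv ℝ u x from funext fun x => (hg x).fderiv]
  exact hc.smul (hu.continuous_fderiv one_ne_zero)

namespace IsStableSystem

variable {n : ℕ} {K : ℝ} {u F P S : EuclideanSpace ℝ (Fin n) → ℝ}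

lemma contDiff_one (h : IsStableSystem K u F P S) : ContDiff ℝ 1 u :=
  h.contDiff.of_le one_le_two

lemma contDiff_one_deriv (h : IsStableSystem K u F P S) : ContDiff ℝ 1 P :=
  contDiff_one_of_hasFDerivAt_smul h.contDiff_one h.continuous_deriv2 h.hasFDerivAt_deriv

lemma contDiff_one_rhs (h : IsStableSystem K u F P S) : ContDiff ℝ 1 F :=
  contDiff_one_of_hasFDerivAt_smul h.contDiff_one h.contDiff_one_deriv.continuous h.hasFDerivAt_rhs

/-- Testing stability with `F η` and the equation with `F P η²` and `u η²`. -/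
lemma integral_energy_le (h : IsStableSystem K u F P S) (hK : 0 ≤ K)
    {η : EuclideanSpace ℝ (Fin n) → ℝ} (hη : ContDiff ℝ 1 η) (hc : HasCompactSupport η)
    (hs : tsupport η ⊆ ball 0 (3 / 4)) :
    ∫ x, η x ^ 2 * (‖gradient F x‖ ^ 2 + ‖gradient u x‖ ^ 2) ≤
      (4 * K + 5) * ∫ x, (F x ^ 2 + u x ^ 2) * (‖gradient η x‖ ^ 2 + η x ^ 2) := by
  have hu := h.contDiff_one
  have hF := h.contDiff_one_rhs
  have hP := h.contDiff_one_deriv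
  have hFη : ContDiff ℝ 1 fun x => F x * η x := hF.mul hη
  have hηη : ContDiff ℝ 1 fun x => η x * η x := hη.mul hη
  have hFP : ContDiff ℝ 1 fun x => F x * P x := hF.mul hP
  have hφ : ContDiff ℝ 1 fun x => (F x * P x) * (η x * η x) := hFP.mul hηη
  have hψ : ContDiff ℝ 1 fun x => u x * (η x * η x) := hu.mul hηη
  have cηη : HasCompactSupport fun x => η x * η x := hc.mul_right
  have cφ : HasCompactSupport fun x => (F x * P x) * (η x * η x) := cηη.mul_left
  have cψ : HasCompactSupport fun x => u x * (η x * η x) := cηη.mul_left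
  have cFη : HasCompactSupport fun x => F x * η x := hc.mul_left
  have gu := continuous_gradient hu
  have gF := continuous_gradient hF
  have gη := continuous_gradient hη
  have hl := continuous_lap h.contDiff
  have uc := hu.continuous
  have Fc := hF.continuous
  have Pc := hP.continuous
  have ηc := hη.continuous
  have A1 := secondVariation_nonneg_of_contDiff_one hP.continuous isOpen_ball h.stable hFη cFη
    ((tsupport_mul_subset_right).trans hs)
  have A2 := integral_inner_gradient_add_mul_lap h.contDiff hφ cφ
  have A3 := integral_inner_gradient_add_mul_lap h.contDiff hψ cψ
  have cg := hc.gradient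
  have hη0 : ∀ x ∉ tsupport η, η x = 0 ∧ gradient η x = 0 := fun x hx =>
    ⟨image_eq_zero_of_notMem_tsupport hx, gradient_eq_zero_of_notMem_tsupport hx⟩
  have integ : ∀ k : EuclideanSpace ℝ (Fin n) → ℝ, Continuous k →
      (∀ x, η x = 0 → gradient η x = 0 → k x = 0) → Integrable k := fun k hk h0 =>
    hk.integrable_of_hasCompactSupport (HasCompactSupport.intro hc.isCompact
      fun x hx => h0 x (hη0 x hx).1 (hη0 x hx).2)
  have dη := fun x => hη.differentiable one_ne_zero x
  have e1 : ∀ x, gradient (fun y => F y * η y) x = F x • gradient η x +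
      η x • P x • gradient u x := fun x => by
    rw [gradient_mul (hF.differentiable one_ne_zero x) (dη x),
      (h.hasFDerivAt_rhs x).gradient_eq_of_smul]
  have e2 : ∀ x, gradient (fun y => (F y * P y) * (η y * η y)) x =
      (F x * P x) • (η x • gradient η x + η x • gradient η x) +
      (η x * η x) • (F x • S x • gradient u x + P x • P x • gradient u x) := fun x => by
    rw [gradient_mul (hFP.differentiable one_ne_zero x) (hηη.differentiable one_ne_zero x),
      gradient_mul (dη x) (dη x), gradient_mul (hF.differentiable one_ne_zero x)
      (hP.differentiable one_ne_zero x), (h.hasFDerivAt_rhs x).gradient_eq_of_smul,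
      (h.hasFDerivAt_deriv x).gradient_eq_of_smul]
  have e3 : ∀ x, gradient (fun y => u y * (η y * η y)) x =
      u x • (η x • gradient η x + η x • gradient η x) + (η x * η x) • gradient u x := fun x => by
    rw [gradient_mul (hu.differentiable one_ne_zero x) (hηη.differentiable one_ne_zero x),
      gradient_mul (dη x) (dη x)]
  have gF' : ∀ x, ‖gradient F x‖ ^ 2 = P x ^ 2 * ‖gradient u x‖ ^ 2 := fun x => by
    rw [(h.hasFDerivAt_rhs x).gradient_eq_of_smul, norm_smul, mul_pow, Real.norm_eq_abs, sq_abs]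
  set a1 : EuclideanSpace ℝ (Fin n) → ℝ := fun x =>
    ‖gradient (fun y => F y * η y) x‖ ^ 2 - P x * (F x * η x) ^ 2 with ha1
  set a2 : EuclideanSpace ℝ (Fin n) → ℝ := fun x =>
    inner ℝ (gradient (fun y => (F y * P y) * (η y * η y)) x) (gradient u x) +
      (F x * P x) * (η x * η x) * lap u x with ha2
  set a3 : EuclideanSpace ℝ (Fin n) → ℝ := fun x =>
    inner ℝ (gradient (fun y => u y * (η y * η y)) x) (gradient u x) +
      u x * (η x * η x) * lap u x with ha3
  set R : EuclideanSpace ℝ (Fin n) → ℝ := fun x =>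
    (F x ^ 2 + u x ^ 2) * (‖gradient η x‖ ^ 2 + η x ^ 2) with hR
  set D : EuclideanSpace ℝ (Fin n) → ℝ := fun x =>
    η x ^ 2 * (‖gradient F x‖ ^ 2 + ‖gradient u x‖ ^ 2) with hD
  have ia1 : Integrable a1 := integ _ (((continuous_gradient hFη).norm.pow 2).sub (by fun_prop))
    fun x h0 h1 => by simp [ha1, e1, h0, h1]
  have ia2 : Integrable a2 := integ _ (((continuous_gradient hφ).inner gu).add (by fun_prop))
    fun x h0 h1 => by simp [ha2, e2, h0]
  have ia3 : Integrable a3 := integ _ (((continuous_gradient hψ).inner gu).add (by fun_prop))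
    fun x h0 h1 => by simp [ha3, e3, h0]
  have iR : Integrable R := integ _ (by fun_prop) fun x h0 h1 => by simp [hR, h0, h1]
  have iD : Integrable D := integ _ (by fun_prop) fun x h0 h1 => by simp [hD, h0]
  have hpt : ∀ x, a1 x - a2 x - 2 * (K + 1) * a3 x ≤ (4 * K + 5) * R x - D x := by
    intro x
    have hηl : η x * lap u x = -(η x * F x) := by
      by_cases hx : x ∈ tsupport η
      · rw [← h.neg_lap_eq x (hs hx)]; ring
      · rw [(hη0 x hx).1]; ring
    have hS := h.sq_sub_le x
    simp only [ha1, ha2, ha3, hR, hD]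
    rw [gF', e1, e2, e3]
    have hsq := real_inner_self_nonneg (x := η x • gradient u x + (2 * u x) • gradient η x)
    rw [← real_inner_self_eq_norm_sq, ← real_inner_self_eq_norm_sq, ← real_inner_self_eq_norm_sq]
    simp only [inner_add_left, inner_add_right, real_inner_smul_left, real_inner_smul_right]
      at hsq ⊢
    rw [real_inner_comm (gradient η x) (gradient u x)] at *
    have hb : 0 ≤ inner ℝ (gradient η x) (gradient η x) := real_inner_self_nonneg
    have ha : 0 ≤ inner ℝ (gradient u x) (gradient u x) := real_inner_self_nonneg
    generalize inner ℝ (gradient u x) (gradient u x) = a at *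
    generalize inner ℝ (gradient η x) (gradient η x) = b at *
    generalize inner ℝ (gradient u x) (gradient η x) = c at *
    generalize lap u x = l at *
    generalize F x = f at *
    generalize u x = v at *
    generalize P x = p at *
    generalize S x = q at *
    generalize η x = e at *
    have l1 : f * p * (e * e) * l = -(f ^ 2 * p * e ^ 2) := by
      calc f * p * (e * e) * l = f * p * e * (e * l) := by ring
        _ = _ := by rw [hηl]; ring
    have l2 : v * (e * e) * l = -(v * f * e ^ 2) := by
      calc v * (e * e) * l = v * e * (e * l) := by ring
        _ = _ := by rw [hηl]; ring
    rw [l1, l2]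
    have m1 := mul_le_mul_of_nonneg_right hS (mul_nonneg (sq_nonneg e) ha)
    have m2 := mul_nonneg (by linarith : 0 ≤ K + 1) hsq
    have m3 := mul_nonneg (by linarith : 0 ≤ K + 1)
      (mul_nonneg (sq_nonneg (v - f)) (sq_nonneg e))
    have m4 := mul_nonneg (by linarith : 0 ≤ 4 * K + 4) (mul_nonneg (sq_nonneg f) hb)
    have m5 := mul_nonneg (by linarith : 0 ≤ 3 * K + 4)
      (mul_nonneg (add_nonneg (sq_nonneg f) (sq_nonneg v)) (sq_nonneg e))
    have m6 := mul_nonneg (sq_nonneg v) hb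
    nlinarith
  have h_integrable := integral_mono ((ia1.sub ia2).sub (ia3.const_mul (2 * (K + 1))))
    ((iR.const_mul (4 * K + 5)).sub iD) hpt
  have s1 := integral_sub (ia1.sub ia2) (ia3.const_mul (2 * (K + 1)))
  have s2 := integral_sub ia1 ia2
  have s3 := integral_sub (iR.const_mul (4 * K + 5)) iD
  rw [integral_const_mul] at s1 s3
  simp only [Pi.sub_apply] at h_integrable s1 s2 s3
  have A1' : 0 ≤ ∫ x, a1 x := A1
  have A2' : ∫ x, a2 x = 0 := A2
  have A3' : ∫ x, a3 x = 0 := A3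
  change ∫ x, D x ≤ (4 * K + 5) * ∫ x, R x
  rw [A2'] at s2
  rw [A3'] at s1
  linarith

lemma continuous_sq_add_sq (h : IsStableSystem K u F P S) :
    Continuous fun x => F x ^ 2 + u x ^ 2 :=
  (h.contDiff_one_rhs.continuous.pow 2).add (h.contDiff_one.continuous.pow 2)

lemma setIntegral_energy_le (h : IsStableSystem K u F P S) (hK : 0 ≤ K) {C r s : ℝ}
    {η : EuclideanSpace ℝ (Fin n) → ℝ} (hη : IsCutoff C r s η) (hrs : r < s) (hr : 0 ≤ r)
    (hs : s < 3 / 4) :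
    ∫ x in closedBall (0 : EuclideanSpace ℝ (Fin n)) r,
        (‖gradient F x‖ ^ 2 + ‖gradient u x‖ ^ 2) ≤
      (4 * K + 5) * (C ^ 2 + 1) / (s - r) ^ 2 *
        ∫ x in closedBall (0 : EuclideanSpace ℝ (Fin n)) s, (F x ^ 2 + u x ^ 2) := by
  have gu := continuous_gradient h.contDiff_one
  have gF := continuous_gradient h.contDiff_one_rhs
  have gη := continuous_gradient hη.contDiff_one
  have ηc := hη.contDiff_one.continuous
  have Gc := h.continuous_sq_add_sq
  have hd : 0 < s - r := by linarith
  have h1 := h.integral_energy_le hK hη.contDiff_one hη.hasCompactSupport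
    (hη.tsupport_subset.trans (closedBall_subset_ball hs))
  have h2 : ∫ x in closedBall (0 : EuclideanSpace ℝ (Fin n)) r,
      (‖gradient F x‖ ^ 2 + ‖gradient u x‖ ^ 2) ≤
      ∫ x, η x ^ 2 * (‖gradient F x‖ ^ 2 + ‖gradient u x‖ ^ 2) := by
    have hk : Continuous fun x => η x ^ 2 * (‖gradient F x‖ ^ 2 + ‖gradient u x‖ ^ 2) := by
      fun_prop
    refine setIntegral_closedBall_le_integral (by fun_prop)
      (hk.integrable_of_hasCompactSupport (HasCompactSupport.mul_right
        (hη.hasCompactSupport.comp_left (g := fun t : ℝ => t ^ 2) (by simp))))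
      (fun x => by positivity) fun x hx => ?_
    rw [hη.eq_one x hx]
    simp
  have h3 : ∫ x, (F x ^ 2 + u x ^ 2) * (‖gradient η x‖ ^ 2 + η x ^ 2) ≤
      ∫ x in closedBall (0 : EuclideanSpace ℝ (Fin n)) s,
        (C ^ 2 + 1) / (s - r) ^ 2 * (F x ^ 2 + u x ^ 2) := by
    refine integral_le_setIntegral_closedBall (by fun_prop) (by fun_prop) (fun x hx => ?_)
      fun x _ => ?_
    · simp [hη.eq_zero hx, hη.gradient_eq_zero hx]
    · rw [mul_comm]
      refine mul_le_mul_of_nonneg_right ?_ (by positivity)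
      rw [add_div]
      refine add_le_add (hη.norm_gradient_sq_le x) ((hη.sq_le_one x).trans ?_)
      exact (one_le_div (by positivity)).2 (pow_le_one₀ hd.le (by linarith))
  rw [integral_const_mul] at h3
  calc _ ≤ _ := h2
    _ ≤ _ := h1
    _ ≤ (4 * K + 5) * ((C ^ 2 + 1) / (s - r) ^ 2 *
        ∫ x in closedBall (0 : EuclideanSpace ℝ (Fin n)) s, (F x ^ 2 + u x ^ 2)) := by gcongr
    _ = _ := by ring

/-- Absorbing estimate for the `L²` norms on nested balls. -/
lemma setIntegral_sq_add_sq_le (h : IsStableSystem K u F P S) (hK : 0 ≤ K) {C : ℝ}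
    (hC : ∀ r s : ℝ, 1 / 2 ≤ r → r < s → s ≤ 1 →
      ∃ η : EuclideanSpace ℝ (Fin n) → ℝ, IsCutoff C r s η)
    {r d ε : ℝ} (hr : 1 / 2 ≤ r) (hd : 0 < d) (hrd : r + 2 * d ≤ 5 / 8) (hε : 0 < ε) :
    ∫ x in closedBall (0 : EuclideanSpace ℝ (Fin n)) r, (F x ^ 2 + u x ^ 2) ≤
      ε ^ 2 / d ^ 2 * ((4 * K + 5) * (C ^ 2 + 1) + C ^ 2) *
        (∫ x in closedBall (0 : EuclideanSpace ℝ (Fin n)) (r + 2 * d), (F x ^ 2 + u x ^ 2)) +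
      (volume.real (ball (0 : EuclideanSpace ℝ (Fin n)) ε))⁻¹ *
        ((∫ x in closedBall (0 : EuclideanSpace ℝ (Fin n)) (5 / 8), F x) ^ 2 +
          (∫ x in closedBall (0 : EuclideanSpace ℝ (Fin n)) (5 / 8), u x) ^ 2) := by
  obtain ⟨η, hη⟩ := hC r (r + d) hr (by linarith) (by linarith)
  obtain ⟨ζ, hζ⟩ := hC (r + d) (r + 2 * d) (by linarith) (by linarith) (by linarith)
  have hF := h.contDiff_one_rhs
  have hu := h.contDiff_one
  have Fc := hF.continuous
  have uc := hu.continuous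
  have gF := continuous_gradient hF
  have gu := continuous_gradient hu
  have split : ∀ (a b : EuclideanSpace ℝ (Fin n) → ℝ) (ρ : ℝ), Continuous a → Continuous b →
      ∫ x in closedBall (0 : EuclideanSpace ℝ (Fin n)) ρ, (a x + b x) =
        (∫ x in closedBall (0 : EuclideanSpace ℝ (Fin n)) ρ, a x) +
          ∫ x in closedBall (0 : EuclideanSpace ℝ (Fin n)) ρ, b x := fun a b ρ ha hb =>
    integral_add (ha.integrableOn_closedBall_zero ρ) (hb.integrableOn_closedBall_zero ρ)
  have e1 := h.setIntegral_energy_le hK hζ (by linarith) (by linarith) (by linarith)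
  have e2 := hη.setIntegral_sq_le hF hε
  have e3 := hη.setIntegral_sq_le hu hε
  have hmono : ∀ g : EuclideanSpace ℝ (Fin n) → ℝ, Continuous g → (∀ x, 0 ≤ g x) →
      (∫ x in closedBall (0 : EuclideanSpace ℝ (Fin n)) (r + d), |g x|) ^ 2 ≤
        (∫ x in closedBall (0 : EuclideanSpace ℝ (Fin n)) (5 / 8), g x) ^ 2 := by
    intro g hg h0
    simp_rw [abs_of_nonneg (h0 _)]
    exact pow_le_pow_left₀ (integral_nonneg h0)
      (setIntegral_closedBall_mono hg h0 (by linarith)) 2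
  have e4 := hmono F Fc h.rhs_nonneg
  have e5 := hmono u uc h.nonneg
  have e6 := setIntegral_closedBall_mono h.continuous_sq_add_sq (fun x => by positivity)
    (by linarith : r + d ≤ r + 2 * d)
  have e7 : (volume.real (ball (0 : EuclideanSpace ℝ (Fin n)) ε))⁻¹ *
      ((∫ x in closedBall (0 : EuclideanSpace ℝ (Fin n)) (r + d), |F x|) ^ 2 +
        (∫ x in closedBall (0 : EuclideanSpace ℝ (Fin n)) (r + d), |u x|) ^ 2) ≤ _ :=
    mul_le_mul_of_nonneg_left (add_le_add e4 e5) (by positivity)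
  have e8 := mul_le_mul_of_nonneg_left e1 (sq_nonneg ε)
  have e9 := mul_le_mul_of_nonneg_left e6 (by positivity : 0 ≤ ε ^ 2 * (C ^ 2 / d ^ 2))
  rw [show r + d - r = d by ring] at e2 e3
  rw [show r + 2 * d - (r + d) = d by ring] at e8
  rw [split _ _ _ (by fun_prop) (by fun_prop)] at e8
  rw [split (fun x => F x ^ 2) (fun x => u x ^ 2) (r + d) (by fun_prop) (by fun_prop)] at e9
  rw [split (fun x => F x ^ 2) (fun x => u x ^ 2) r (by fun_prop) (by fun_prop)]
  calc _ ≤ _ := add_le_add e2 e3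
    _ ≤ ε ^ 2 * ((4 * K + 5) * (C ^ 2 + 1) / d ^ 2 *
          ∫ x in closedBall (0 : EuclideanSpace ℝ (Fin n)) (r + 2 * d), (F x ^ 2 + u x ^ 2)) +
        ε ^ 2 * (C ^ 2 / d ^ 2) *
          (∫ x in closedBall (0 : EuclideanSpace ℝ (Fin n)) (r + 2 * d), (F x ^ 2 + u x ^ 2)) +
        (volume.real (ball (0 : EuclideanSpace ℝ (Fin n)) ε))⁻¹ *
          ((∫ x in closedBall (0 : EuclideanSpace ℝ (Fin n)) (5 / 8), F x) ^ 2 +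
            (∫ x in closedBall (0 : EuclideanSpace ℝ (Fin n)) (5 / 8), u x) ^ 2) := by linarith
    _ = _ := by ring

end IsStableSystem

lemma exists_bound_abs_lap {n : ℕ} {η : EuclideanSpace ℝ (Fin n) → ℝ} (hη : ContDiff ℝ 2 η)
    (hc : HasCompactSupport η) : ∃ B : ℝ, ∀ x, |lap η x| ≤ B :=
  (continuous_lap hη).bounded_above_of_compact_support
    (HasCompactSupport.intro hc.isCompact fun _ hx => lap_eq_zero_of_notMem_tsupport hx)

namespace IsStableSystem

variable {n : ℕ} {K : ℝ} {u F P S : EuclideanSpace ℝ (Fin n) → ℝ}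

lemma setIntegral_rhs_le (h : IsStableSystem K u F P S) {C r s B : ℝ}
    {η : EuclideanSpace ℝ (Fin n) → ℝ} (hη : IsCutoff C r s η) (hs : s < 3 / 4)
    (hB : ∀ x, |lap η x| ≤ B) :
    ∫ x in closedBall (0 : EuclideanSpace ℝ (Fin n)) r, F x ≤
      B * ∫ x in closedBall (0 : EuclideanSpace ℝ (Fin n)) s, u x := by
  have hη2 := hη.contDiff_two
  have Fc := h.contDiff_one_rhs.continuous
  have uc := h.contDiff.continuous
  have ηF : Continuous fun x => η x * F x := hη2.continuous.mul Fc
  calc ∫ x in closedBall (0 : EuclideanSpace ℝ (Fin n)) r, F x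
      ≤ ∫ x, η x * F x := by
        refine setIntegral_closedBall_le_integral Fc
          (ηF.integrable_of_hasCompactSupport hη.hasCompactSupport.mul_right)
          (fun x => mul_nonneg (hη.nonneg x) (h.rhs_nonneg x)) fun x hx => ?_
        rw [hη.eq_one x hx, one_mul]
    _ = ∫ x, -(η x * lap u x) := by
        refine integral_congr_ae (ae_of_all _ fun x => ?_)
        by_cases hx : x ∈ closedBall (0 : EuclideanSpace ℝ (Fin n)) s
        · simp only
          rw [← h.neg_lap_eq x (closedBall_subset_ball hs hx)]
          ring
        · simp [hη.eq_zero hx]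
    _ = ∫ x, -(u x * lap η x) := by
        rw [integral_neg, integral_neg, integral_mul_lap_comm h.contDiff h.hasCompactSupport hη2
          hη.hasCompactSupport]
    _ ≤ ∫ x in closedBall (0 : EuclideanSpace ℝ (Fin n)) s, B * u x := by
        refine integral_le_setIntegral_closedBall (uc.mul (continuous_lap hη2)).neg
          (continuous_const.mul uc) (fun x hx => ?_) fun x _ => ?_
        · rw [lap_eq_zero_of_notMem_tsupport fun h' => hx (hη.tsupport_subset h')]
          ring
        · rw [← mul_neg, mul_comm]
          exact mul_le_mul_of_nonneg_right ((neg_le_abs _).trans (hB x)) (h.nonneg x)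
    _ = _ := integral_const_mul _ _

end IsStableSystem

/-- The interior `W^{1,2}` estimate for stable systems. -/
lemma exists_isStableSystem_bound (n : ℕ) {K : ℝ} (hK : 0 ≤ K) :
    ∃ A : ℝ, 0 ≤ A ∧ ∀ u F P S : EuclideanSpace ℝ (Fin n) → ℝ, IsStableSystem K u F P S →
      ∫ x in ball (0 : EuclideanSpace ℝ (Fin n)) (1 / 2), (F x ^ 2 + ‖gradient F x‖ ^ 2) ≤
        A * (∫ x in ball (0 : EuclideanSpace ℝ (Fin n)) (3 / 4), u x) ^ 2 := by
  obtain ⟨C, -, hC⟩ := exists_cutoff (EuclideanSpace ℝ (Fin n))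
  obtain ⟨η, hη⟩ := hC (5 / 8) (11 / 16) (by norm_num) (by norm_num) (by norm_num)
  obtain ⟨ζ, hζ⟩ := hC (1 / 2) (9 / 16) (by norm_num) (by norm_num) (by norm_num)
  obtain ⟨B, hB⟩ := exists_bound_abs_lap hη.contDiff_two hη.hasCompactSupport
  set V := volume.real (ball (0 : EuclideanSpace ℝ (Fin n)) 1) with hV
  have hVpos : 0 < V :=
    ENNReal.toReal_pos (measure_ball_pos _ _ one_pos).ne' measure_ball_lt_top.ne
  set Q := (4 * K + 5) * (C ^ 2 + 1) + C ^ 2 with hQ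
  have hQpos : 0 < Q := by positivity
  set δ := Real.sqrt ((1 / 2) ^ n / 2 / Q) with hδ
  have hδpos : 0 < δ := Real.sqrt_pos.2 (by positivity)
  have hδQ : δ ^ 2 * Q = (1 / 2) ^ n / 2 := by
    rw [hδ, Real.sq_sqrt (by positivity)]
    field_simp
  set A₁ := (4 / δ) ^ n * V⁻¹ * (B ^ 2 + 1) with hA₁
  set A₂ := 16 ^ n * (2 * A₁) with hA₂
  refine ⟨(1 + (4 * K + 5) * (C ^ 2 + 1) / (9 / 16 - 1 / 2) ^ 2) * A₂, by positivity,
    fun u F P S h => ?_⟩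
  set M := ∫ x in ball (0 : EuclideanSpace ℝ (Fin n)) (3 / 4), u x with hM
  set G : ℝ → ℝ := fun r =>
    ∫ x in closedBall (0 : EuclideanSpace ℝ (Fin n)) r, (F x ^ 2 + u x ^ 2) with hG
  have uc := h.contDiff.continuous
  have Fc := h.contDiff_one_rhs.continuous
  have Gc := h.continuous_sq_add_sq
  have hGmono : ∀ r s, r ≤ s → G r ≤ G s := fun r s hrs =>
    setIntegral_closedBall_mono Gc (fun x => by positivity) hrs
  have hG0 : ∀ r, 0 ≤ G r := fun r => integral_nonneg fun x => by positivity
  have huM : ∀ s < 3 / 4, ∫ x in closedBall (0 : EuclideanSpace ℝ (Fin n)) s, u x ≤ M :=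
    fun s hs => setIntegral_mono_set
      ((uc.integrableOn_closedBall_zero (3 / 4)).mono_set ball_subset_closedBall)
      (ae_of_all _ h.nonneg) (closedBall_subset_ball hs).eventuallyLE
  have hB0 : 0 ≤ B := (abs_nonneg _).trans (hB 0)
  have hFM : ∫ x in closedBall (0 : EuclideanSpace ℝ (Fin n)) (5 / 8), F x ≤ B * M :=
    (h.setIntegral_rhs_le hη (by norm_num) hB).trans
      (mul_le_mul_of_nonneg_left (huM _ (by norm_num)) hB0)
  have hN : (∫ x in closedBall (0 : EuclideanSpace ℝ (Fin n)) (5 / 8), F x) ^ 2 +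
      (∫ x in closedBall (0 : EuclideanSpace ℝ (Fin n)) (5 / 8), u x) ^ 2 ≤
      (B ^ 2 + 1) * M ^ 2 := by
    have h1 := pow_le_pow_left₀ (integral_nonneg h.rhs_nonneg) hFM 2
    have h2 := pow_le_pow_left₀ (integral_nonneg h.nonneg) (huM (5 / 8) (by norm_num)) 2
    linarith
  have hstep : ∀ ρ, 0 < ρ → ρ ≤ 1 / 8 → ρ ^ n * G (5 / 8 - ρ) ≤
      ((ρ / 2) ^ n * G (5 / 8 - ρ / 2)) / 2 + A₁ * M ^ 2 := by
    intro ρ h0 h1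
    have hs := h.setIntegral_sq_add_sq_le hK hC (r := 5 / 8 - ρ) (d := ρ / 4)
      (ε := δ * (ρ / 4)) (by linarith) (by linarith) (by linarith) (by positivity)
    have hvol : volume.real (ball (0 : EuclideanSpace ℝ (Fin n)) (δ * (ρ / 4))) =
        (δ * (ρ / 4)) ^ n * V := by
      rw [hV, measureReal_def, measureReal_def, Measure.addHaar_ball_of_pos _ _ (by positivity),
        ENNReal.toReal_mul, ENNReal.toReal_ofReal (by positivity), finrank_euclideanSpace_fin]
    rw [hvol, show 5 / 8 - ρ + 2 * (ρ / 4) = 5 / 8 - ρ / 2 by ring,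
      show (δ * (ρ / 4)) ^ 2 / (ρ / 4) ^ 2 * Q = (1 / 2) ^ n / 2 by
        rw [← hδQ, mul_pow]; field_simp] at hs
    have hs' : G (5 / 8 - ρ) ≤ (1 / 2) ^ n / 2 * G (5 / 8 - ρ / 2) +
        ((δ * (ρ / 4)) ^ n * V)⁻¹ * ((B ^ 2 + 1) * M ^ 2) :=
      hs.trans (add_le_add le_rfl (mul_le_mul_of_nonneg_left hN (by positivity)))
    calc ρ ^ n * G (5 / 8 - ρ) ≤ ρ ^ n * ((1 / 2) ^ n / 2 * G (5 / 8 - ρ / 2) +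
          ((δ * (ρ / 4)) ^ n * V)⁻¹ * ((B ^ 2 + 1) * M ^ 2)) := by gcongr
      _ = _ := by
        rw [hA₁, div_pow, div_pow, mul_pow, div_pow, div_pow, one_pow]
        field_simp
  have hbd : ∀ ρ, 0 < ρ → ρ ≤ 1 / 8 → ρ ^ n * G (5 / 8 - ρ) ≤ G (5 / 8) := by
    intro ρ h0 h1
    calc ρ ^ n * G (5 / 8 - ρ) ≤ 1 * G (5 / 8) := by
          gcongr
          · exact pow_le_one₀ h0.le (by linarith)
          · exact hGmono _ _ (by linarith)
      _ = _ := one_mul _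
  have hit := le_two_mul_of_le_half_add (H := fun ρ => ρ ^ n * G (5 / 8 - ρ)) (by positivity)
    hbd hstep (ρ := 1 / 16) (by norm_num) (by norm_num)
  have hGA : G (9 / 16) ≤ A₂ * M ^ 2 := by
    have : (16 : ℝ) ^ n * ((1 / 16) ^ n * G (5 / 8 - 1 / 16)) = G (9 / 16) := by
      rw [← mul_assoc, ← mul_pow]
      norm_num
    rw [← this, hA₂]
    calc (16 : ℝ) ^ n * ((1 / 16) ^ n * G (5 / 8 - 1 / 16)) ≤ 16 ^ n * (2 * (A₁ * M ^ 2)) := by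
          gcongr
      _ = _ := by ring
  have hen := h.setIntegral_energy_le hK hζ (by norm_num) (by norm_num) (by norm_num)
  have gF := continuous_gradient h.contDiff_one_rhs
  have gu := continuous_gradient h.contDiff_one
  have i0 : Continuous fun x => F x ^ 2 + ‖gradient F x‖ ^ 2 := by fun_prop
  have i1 : Continuous fun x => ‖gradient F x‖ ^ 2 + ‖gradient u x‖ ^ 2 := by fun_prop
  calc ∫ x in ball (0 : EuclideanSpace ℝ (Fin n)) (1 / 2), (F x ^ 2 + ‖gradient F x‖ ^ 2)
      ≤ ∫ x in closedBall (0 : EuclideanSpace ℝ (Fin n)) (1 / 2),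
          (F x ^ 2 + ‖gradient F x‖ ^ 2) :=
        setIntegral_mono_set (i0.integrableOn_closedBall_zero _)
          (ae_of_all _ fun x => by positivity) ball_subset_closedBall.eventuallyLE
    _ ≤ ∫ x in closedBall (0 : EuclideanSpace ℝ (Fin n)) (1 / 2),
          ((F x ^ 2 + u x ^ 2) + (‖gradient F x‖ ^ 2 + ‖gradient u x‖ ^ 2)) :=
        setIntegral_mono_on (i0.integrableOn_closedBall_zero _)
          ((Gc.add i1).integrableOn_closedBall_zero _) measurableSet_closedBall fun x _ => by
            linarith [sq_nonneg (u x), sq_nonneg ‖gradient u x‖]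
    _ = G (1 / 2) + ∫ x in closedBall (0 : EuclideanSpace ℝ (Fin n)) (1 / 2),
          (‖gradient F x‖ ^ 2 + ‖gradient u x‖ ^ 2) :=
        integral_add (Gc.integrableOn_closedBall_zero _) (i1.integrableOn_closedBall_zero _)
    _ ≤ G (9 / 16) + (4 * K + 5) * (C ^ 2 + 1) / (9 / 16 - 1 / 2) ^ 2 * G (9 / 16) :=
        add_le_add (hGmono _ _ (by norm_num)) hen
    _ = (1 + (4 * K + 5) * (C ^ 2 + 1) / (9 / 16 - 1 / 2) ^ 2) * G (9 / 16) := by ring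
    _ ≤ (1 + (4 * K + 5) * (C ^ 2 + 1) / (9 / 16 - 1 / 2) ^ 2) * (A₂ * M ^ 2) := by gcongr
    _ = _ := by ring

/-- Localizing a stable solution by a cutoff gives a stable system on the whole space. -/
lemma exists_isStableSystem {n : ℕ} {θ K : ℝ} (hθ : 0 < θ) {f f' f'' : ℝ → ℝ}
    {u : EuclideanSpace ℝ (Fin n) → ℝ} (hf : C2On01 f f' f'')
    (hf0 : ∀ t ∈ Ico (0 : ℝ) 1, 0 ≤ f t)
    (hf2 : ∀ t ∈ Ico (0 : ℝ) 1, (1 + θ) * f' t ^ 2 - K ≤ f'' t * f t)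
    (hu : ContDiffOn ℝ 2 u (ball (0 : EuclideanSpace ℝ (Fin n)) 1))
    (hu01 : ∀ x ∈ ball (0 : EuclideanSpace ℝ (Fin n)) 1, 0 ≤ u x ∧ u x < 1)
    (hlap : ∀ x ∈ ball (0 : EuclideanSpace ℝ (Fin n)) 1, -lap u x = f (u x))
    (hst : StableSol f' u (ball 0 1)) :
    ∃ v : EuclideanSpace ℝ (Fin n) → ℝ,
      EqOn v u (ball (0 : EuclideanSpace ℝ (Fin n)) (3 / 4)) ∧
      IsStableSystem K v (f ∘ v) (f' ∘ v) (f'' ∘ v) := by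
  let χ : ContDiffBump (0 : EuclideanSpace ℝ (Fin n)) := ⟨3 / 4, 7 / 8, by norm_num, by norm_num⟩
  have hχ1 : ∀ x ∈ ball (0 : EuclideanSpace ℝ (Fin n)) (3 / 4), χ x = 1 := fun x hx =>
    χ.one_of_mem_closedBall (ball_subset_closedBall hx)
  have hχ0 : ∀ x ∉ ball (0 : EuclideanSpace ℝ (Fin n)) 1, x ∉ tsupport χ := fun x hx hx' => by
    rw [χ.tsupport_eq] at hx'
    exact hx (closedBall_subset_ball (by norm_num : (7 / 8 : ℝ) < 1) hx')
  set v : EuclideanSpace ℝ (Fin n) → ℝ := fun x => χ x * u x with hv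
  have hvu : EqOn v u (ball (0 : EuclideanSpace ℝ (Fin n)) (3 / 4)) := fun x hx => by
    simp [hv, hχ1 x hx]
  have hv01 : ∀ x, v x ∈ Ico (0 : ℝ) 1 := fun x => by
    by_cases hx : x ∈ ball (0 : EuclideanSpace ℝ (Fin n)) 1
    · obtain ⟨h0, h1⟩ := hu01 x hx
      exact ⟨mul_nonneg χ.nonneg h0, (mul_le_of_le_one_left h0 χ.le_one).trans_lt h1⟩
    · simp [hv, image_eq_zero_of_notMem_tsupport (hχ0 x hx)]
  have hvc : ContDiff ℝ 2 v := contDiff_iff_contDiffAt.2 fun x => by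
    by_cases hx : x ∈ ball (0 : EuclideanSpace ℝ (Fin n)) 1
    · exact χ.contDiff.contDiffAt.mul (hu.contDiffAt (isOpen_ball.mem_nhds hx))
    · refine (contDiffAt_const (c := (0 : ℝ))).congr_of_eventuallyEq ?_
      filter_upwards [notMem_tsupport_iff_eventuallyEq.1 (hχ0 x hx)] with y hy
      simp [hv, hy]
  have hcomp : ∀ g g' : ℝ → ℝ,
      (∀ t ∈ Ico (0 : ℝ) 1, HasDerivWithinAt g (g' t) (Ico (0 : ℝ) 1) t) →
      ∀ x, HasFDerivAt (g ∘ v) ((g' ∘ v) x • fderiv ℝ v x) x := fun g g' hg x => by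
    have h1 := (hvc.differentiable two_ne_zero x).hasFDerivAt
    rw [← hasFDerivWithinAt_univ] at h1 ⊢
    exact (hg (v x) (hv01 x)).comp_hasFDerivWithinAt x h1 fun y _ => hv01 y
  refine ⟨v, hvu, ⟨hvc, χ.hasCompactSupport.mul_right, fun x => (hv01 x).1,
    fun x => hf0 _ (hv01 x), hcomp f f' hf.1, hcomp f' f'' hf.2.1,
    hf.2.2.comp_continuous hvc.continuous hv01, fun x => ?_, fun x hx => ?_, ?_⟩⟩
  · have := hf2 _ (hv01 x)
    simp only [Function.comp_apply]
    nlinarith [mul_nonneg hθ.le (sq_nonneg (f' (v x)))]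
  · have h1 : v =ᶠ[𝓝 x] u := hvu.eventuallyEq_of_mem (isOpen_ball.mem_nhds hx)
    rw [h1.lap_eq, hlap x (ball_subset_ball (by norm_num) hx), Function.comp_apply, hvu hx]
  · intro ξ hξ hξc hξs
    have h1 := hst ξ hξ hξc (hξs.trans (ball_subset_ball (by norm_num)))
    have h2 : ∀ x, ‖gradient ξ x‖ ^ 2 - f' (u x) * ξ x ^ 2 =
        ‖gradient ξ x‖ ^ 2 - (f' ∘ v) x * ξ x ^ 2 := fun x => by
      by_cases hx : x ∈ tsupport ξ
      · rw [Function.comp_apply, hvu (hξs hx)]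
      · simp [image_eq_zero_of_notMem_tsupport hx]
    simp_rw [h2] at h1
    rwa [setIntegral_eq_integral_of_forall_compl_eq_zero fun x hx => ?_] at h1
    have hxξ : x ∉ tsupport ξ := fun h' =>
      hx (ball_subset_ball (by norm_num : (3 / 4 : ℝ) ≤ 1) (hξs h'))
    simp [image_eq_zero_of_notMem_tsupport hxξ, gradient_eq_zero_of_notMem_tsupport hxξ]

/-- Interior `W^{1,2}` estimate for `f(u)` (Lemma 3.1): for stable solutions of
`-Δu = f(u)` in `B₁` with `f ≥ 0` and `f''f ≥ (1+θ)f'² - K` on `[0,1)`, one has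
`∫_{B_{1/2}} (f(u)² + |∇(f∘u)|²) ≤ C² (∫_{B_{3/4}} u)²` with `C = C(n, θ, K)`. -/
theorem stmt7 (n : ℕ) (hn : 1 ≤ n) (θ K : ℝ) (hθ : 0 < θ) (hK : 0 ≤ K) :
    ∃ C : ℝ, 0 < C ∧
      ∀ (f f' f'' : ℝ → ℝ) (u : EuclideanSpace ℝ (Fin n) → ℝ),
        C2On01 f f' f'' →
        (∀ t ∈ Ico (0:ℝ) 1, 0 ≤ f t) →
        (∀ t ∈ Ico (0:ℝ) 1, (1 + θ) * f' t ^ 2 - K ≤ f'' t * f t) →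
        ContDiffOn ℝ 2 u (ball (0:EuclideanSpace ℝ (Fin n)) 1) →
        (∀ x ∈ ball (0:EuclideanSpace ℝ (Fin n)) 1, 0 ≤ u x ∧ u x < 1) →
        (∀ x ∈ ball (0:EuclideanSpace ℝ (Fin n)) 1, -lap u x = f (u x)) →
        StableSol f' u (ball 0 1) →
        (∫ x in ball (0:EuclideanSpace ℝ (Fin n)) (1/2),
            (f (u x) ^ 2 + ‖gradient (fun y => f (u y)) x‖ ^ 2)) ≤
          C ^ 2 * (∫ x in ball (0:EuclideanSpace ℝ (Fin n)) (3/4), u x) ^ 2 := by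
  obtain ⟨A, hA, hbound⟩ := exists_isStableSystem_bound n hK
  refine ⟨A + 1, by positivity, fun f f' f'' u hf hf0 hf2 hu hu01 hlap hst => ?_⟩
  obtain ⟨v, hvu, hv⟩ := exists_isStableSystem hθ hf hf0 hf2 hu hu01 hlap hst
  have h1 : ∫ x in ball (0 : EuclideanSpace ℝ (Fin n)) (1 / 2),
      (f (u x) ^ 2 + ‖gradient (fun y => f (u y)) x‖ ^ 2) =
      ∫ x in ball (0 : EuclideanSpace ℝ (Fin n)) (1 / 2),
        ((f ∘ v) x ^ 2 + ‖gradient (f ∘ v) x‖ ^ 2) := by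
    refine setIntegral_congr_fun measurableSet_ball fun x hx => ?_
    have hx' := ball_subset_ball (by norm_num : (1 / 2 : ℝ) ≤ 3 / 4) hx
    have h2 : (f ∘ v) =ᶠ[𝓝 x] fun y => f (u y) := by
      filter_upwards [isOpen_ball.mem_nhds hx'] with y hy
      rw [Function.comp_apply, hvu hy]
    change f (u x) ^ 2 + _ = _
    rw [h2.gradient_eq, Function.comp_apply, hvu hx']
  have h3 : ∫ x in ball (0 : EuclideanSpace ℝ (Fin n)) (3 / 4), u x =
      ∫ x in ball (0 : EuclideanSpace ℝ (Fin n)) (3 / 4), v x :=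
    setIntegral_congr_fun measurableSet_ball fun x hx => (hvu hx).symm
  rw [h1, h3]
  refine (hbound v _ _ _ hv).trans (mul_le_mul_of_nonneg_right ?_ (sq_nonneg _))
  nlinarith
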